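/- Suppose the linear forms l_1,…,l_p span the full space of linear forms on ℂ^n (equivalently ⋂_{i=1}^p ker l_i = {0}). Then for every integer k ≥ 1 there exist elements g_α of the ideal power (Ideal.span {l_1,…,l_p})^k ⊆ R_s, indexed by the multi-indices α ∈ ℕ^n with |α| = k, such that in M one has ∏_{j=0}^{k−1} (s_1 + ⋯ + s_p + n + j) · 1 = ∑_{|α| = k} (k!/(α_1!⋯α_n!)) · D^α(g_α), where D^α = D_1^{α_1}∘⋯∘D_n^{α_n} (in fact g_α = x^α works). -/

import Mathlib

open MvPolynomial

namespace Arrangement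

variable {n : ℕ} {ι : Type} [Fintype ι]

/-- The module `D(A)` of logarithmic derivations of the arrangement defined by
the forms `l i`. -/
noncomputable def DA (l : ι → MvPolynomial (Fin n) ℂ) :
    Submodule (MvPolynomial (Fin n) ℂ)
      (Derivation ℂ (MvPolynomial (Fin n) ℂ) (MvPolynomial (Fin n) ℂ)) where
  carrier := {χ | ∀ i, χ (l i) ∈ Ideal.span {l i}}
  add_mem' := fun hx hy i => by
    simpa using add_mem (hx i) (hy i)
  zero_mem' := fun i => by simp
  smul_mem' := fun r χ hχ i => by
    simpa using Ideal.mul_mem_left _ r (hχ i)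

open Classical in
/-- The property characterizing the family of twisted derivatives
`D i = ∂/∂xᵢ + ∑ⱼ sⱼ (∂lⱼ/∂xᵢ)/lⱼ` acting on the localization
`M = ℂ[x,s,1/F]·l^s`. -/
def IsTwisted (l : ι → MvPolynomial (Fin n) ℂ)
    (D : Fin n → Module.End ℂ
      (Localization.Away (rename Sum.inl (∏ i, l i) : MvPolynomial (Fin n ⊕ ι) ℂ))) : Prop :=
  (∀ (i : Fin n) (r : MvPolynomial (Fin n ⊕ ι) ℂ)
      (m : Localization.Away (rename Sum.inl (∏ i, l i) : MvPolynomial (Fin n ⊕ ι) ℂ)),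
      D i (algebraMap _ _ r * m)
        = algebraMap _ _ (pderiv (Sum.inl i) r) * m + algebraMap _ _ r * D i m) ∧
  (∀ i : Fin n,
      algebraMap (MvPolynomial (Fin n ⊕ ι) ℂ) _ (rename Sum.inl (∏ j, l j)) * D i 1
        = algebraMap _ _ (∑ j, X (Sum.inr j) *
            rename Sum.inl (pderiv i (l j) * ∏ k ∈ Finset.univ.erase j, l k)))

/-- The algebra `W` of operators on `M`, image of the Weyl algebra
`Aₙ(ℂ)[s₁,…,s_p]` acting on `ℂ[x,s,1/F]·l^s`. -/
noncomputable def Wa (l : ι → MvPolynomial (Fin n) ℂ)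
    (D : Fin n → Module.End ℂ
      (Localization.Away (rename Sum.inl (∏ i, l i) : MvPolynomial (Fin n ⊕ ι) ℂ))) :
    Subalgebra ℂ (Module.End ℂ
      (Localization.Away (rename Sum.inl (∏ i, l i) : MvPolynomial (Fin n ⊕ ι) ℂ))) :=
  Algebra.adjoin ℂ
    ((Set.range fun i : Fin n =>
        LinearMap.mulLeft ℂ (algebraMap _ _ (X (Sum.inl i) : MvPolynomial (Fin n ⊕ ι) ℂ))) ∪
     (Set.range fun j : ι =>
        LinearMap.mulLeft ℂ (algebraMap _ _ (X (Sum.inr j) : MvPolynomial (Fin n ⊕ ι) ℂ))) ∪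
     Set.range D)

/-- The Bernstein ideal `B(A)`, as the set of polynomials `b(s₁,…,s_p)` such that
`b · l^s = P · l^{s+1}` for some operator `P` in the Weyl algebra. -/
noncomputable def Bideal (l : ι → MvPolynomial (Fin n) ℂ)
    (D : Fin n → Module.End ℂ
      (Localization.Away (rename Sum.inl (∏ i, l i) : MvPolynomial (Fin n ⊕ ι) ℂ))) :
    Set (MvPolynomial ι ℂ) :=
  {b | ∃ P ∈ Wa l D,
    algebraMap (MvPolynomial (Fin n ⊕ ι) ℂ) _ ((rename Sum.inr b : MvPolynomial (Fin n ⊕ ι) ℂ))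
      = P (algebraMap _ _ (rename Sum.inl (∏ i, l i) : MvPolynomial (Fin n ⊕ ι) ℂ))}

/-- The linear functional on `ℂⁿ` associated to a linear form. -/
noncomputable def toLin (f : MvPolynomial (Fin n) ℂ) : (Fin n → ℂ) →ₗ[ℂ] ℂ :=
  ∑ i, f.coeff (Finsupp.single i 1) • LinearMap.proj i

/-- The hyperplane `ker lᵢ ⊆ ℂⁿ`. -/
noncomputable def hyp (l : ι → MvPolynomial (Fin n) ℂ) (i : ι) : Submodule ℂ (Fin n → ℂ) :=
  LinearMap.ker (toLin (l i))

open Classical in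
/-- The intersection lattice `L(A)`: all intersections of nonempty subfamilies. -/
noncomputable def LA (l : ι → MvPolynomial (Fin n) ℂ) : Finset (Submodule ℂ (Fin n → ℂ)) :=
  (Finset.univ.powerset.filter Finset.Nonempty).image fun I : Finset ι => ⨅ i ∈ I, hyp l i

open Classical in
/-- `J(X) = {i : X ⊆ ker lᵢ}`. -/
noncomputable def JX (l : ι → MvPolynomial (Fin n) ℂ) (Y : Submodule ℂ (Fin n → ℂ)) :
    Finset ι :=
  Finset.univ.filter fun i => Y ≤ hyp l i

/-- `r(X) = n - dim X`, the codimension. -/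
noncomputable def rX (Y : Submodule ℂ (Fin n → ℂ)) : ℕ :=
  n - Module.finrank ℂ Y

/-- Irreducibility of the subarrangement with hyperplanes indexed by `J`. -/
def IrredOn (l : ι → MvPolynomial (Fin n) ℂ) (J : Finset ι) : Prop :=
  ¬ ∃ V₁ V₂ : Submodule ℂ (Fin n → ℂ), IsCompl V₁ V₂ ∧
      (∀ i ∈ J, V₁ ≤ hyp l i ∨ V₂ ≤ hyp l i) ∧
      (∃ i ∈ J, V₁ ≤ hyp l i) ∧ (∃ i ∈ J, V₂ ≤ hyp l i)

open Classical in
/-- `L'(A) = {X ∈ L(A) : A_X irreducible}`. -/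
noncomputable def Lprime (l : ι → MvPolynomial (Fin n) ℂ) :
    Finset (Submodule ℂ (Fin n → ℂ)) :=
  (LA l).filter fun Y => IrredOn l (JX l Y)

/-- The polynomial
`b_A = ∏_{X ∈ L'(A)} ∏_{j=0}^{2(card J(X) − r(X))} ((∑_{i ∈ J(X)} sᵢ) + r(X) + j)`. -/
noncomputable def bGen (l : ι → MvPolynomial (Fin n) ℂ) : MvPolynomial ι ℂ :=
  ∏ Y ∈ Lprime l, ∏ j ∈ Finset.range (2 * ((JX l Y).card - rX (n := n) Y) + 1),
    ((∑ i ∈ JX l Y, X i) + C ((rX (n := n) Y : ℂ) + (j : ℂ)))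

end Arrangement

namespace Arrangement

/-- `D^α = D₁^{α₁} ∘ ⋯ ∘ Dₙ^{αₙ}` for a family of operators `D`. -/
noncomputable def Dpow {n : ℕ} {M : Type*} [AddCommMonoid M] [Module ℂ M]
    (D : Fin n → Module.End ℂ M) (α : Fin n → ℕ) : Module.End ℂ M :=
  (List.finRange n).foldr (fun i f => (D i) ^ α i * f) 1

end Arrangement

namespace Arrangement

section Pochhammer

open Finset

variable {E : Type*} [Ring E]

theorem ascPochhammer_smeval_succ (a : ℕ) (y : E) :
    (ascPochhammer ℕ (a + 1)).smeval y = (ascPochhammer ℕ a).smeval y * (y + a) := by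
  rw [ascPochhammer_succ_right, Polynomial.smeval_mul, Polynomial.smeval_add,
    Polynomial.smeval_X, Polynomial.smeval_natCast]
  simp

/-- The Chu–Vandermonde identity for rising factorials of commuting elements. -/
theorem ascPochhammer_smeval_add {r s : E} (k : ℕ) (h : Commute r s) :
    (ascPochhammer ℕ k).smeval (r + s) = ∑ ij ∈ antidiagonal k, (k.choose ij.1 : E) *
      ((ascPochhammer ℕ ij.1).smeval r * (ascPochhammer ℕ ij.2).smeval s) := by
  have key : ∀ (a : ℕ) (y : E), (ascPochhammer ℕ a).smeval y =
      Int.negOnePow a • (descPochhammer ℤ a).smeval (-y) := fun a y => by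
    rw [← Polynomial.ascPochhammer_smeval_neg_eq_descPochhammer, neg_neg]
  rw [key, neg_add, Ring.descPochhammer_smeval_add k (h.neg_left.neg_right), Finset.smul_sum]
  refine Finset.sum_congr rfl fun ij hij => ?_
  rw [key, key, ← mem_antidiagonal.mp hij]
  push_cast
  rw [Int.negOnePow_add, smul_mul_smul_comm, mul_smul_comm]

theorem sum_antidiagonalTuple_succ {B : Type*} [AddCommMonoid B] (n k : ℕ)
    (f : (Fin (n + 1) → ℕ) → B) :
    ∑ α ∈ Finset.Nat.antidiagonalTuple (n + 1) k, f α =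
      ∑ ij ∈ antidiagonal k, ∑ β ∈ Finset.Nat.antidiagonalTuple n ij.2, f (Fin.cons ij.1 β) := by
  rw [Finset.sum_sigma']
  refine Finset.sum_bij' (fun α _ => ⟨(α 0, ∑ i, Fin.tail α i), Fin.tail α⟩)
    (fun x _ => Fin.cons x.1.1 x.2) ?_ ?_ ?_ ?_ ?_
  · intro α hα
    rw [Finset.Nat.mem_antidiagonalTuple, Fin.sum_univ_succ] at hα
    simpa [Finset.Nat.mem_antidiagonalTuple, Fin.tail] using hα
  · rintro ⟨⟨i, j⟩, β⟩ h
    simp only [mem_sigma, HasAntidiagonal.mem_antidiagonal, Finset.Nat.mem_antidiagonalTuple] at h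
    simp [Finset.Nat.mem_antidiagonalTuple, Fin.sum_univ_succ, h.1, h.2]
  · intro α _
    simp
  · rintro ⟨⟨i, j⟩, β⟩ h
    simp only [mem_sigma, HasAntidiagonal.mem_antidiagonal, Finset.Nat.mem_antidiagonalTuple] at h
    simp [h.2]
  · intro α _
    simp

theorem multinomial_univ_cons {n : ℕ} (a : ℕ) (β : Fin n → ℕ) :
    Nat.multinomial univ (Fin.cons a β : Fin (n + 1) → ℕ) =
      (a + ∑ i, β i).choose a * Nat.multinomial univ β := by
  rw [Fin.univ_succ, Nat.multinomial_cons]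
  simp [Nat.multinomial]

/-- The multinomial form of the Chu–Vandermonde identity. -/
theorem sum_multinomial_mul_prod_ascPochhammer {n : ℕ} (y : Fin n → E)
    (hy : ∀ i j, Commute (y i) (y j)) (k : ℕ) :
    ∑ α ∈ Finset.Nat.antidiagonalTuple n k, (Nat.multinomial univ α : E) *
        (List.ofFn fun i => (ascPochhammer ℕ (α i)).smeval (y i)).prod =
      (ascPochhammer ℕ k).smeval (∑ i, y i) := by
  induction n generalizing k with
  | zero =>
    cases k with
    | zero => simp
    | succ k =>
      rw [ascPochhammer_succ_left, mul_comm]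
      simp [Polynomial.smeval_mul, Polynomial.smeval_X]
  | succ n ih =>
    rw [Fin.sum_univ_succ, ascPochhammer_smeval_add k
      (Commute.sum_right _ _ _ fun i _ => hy 0 i.succ), sum_antidiagonalTuple_succ]
    refine Finset.sum_congr rfl fun ij hij => ?_
    rw [← ih (fun i => y i.succ) (fun i j => hy _ _), Finset.mul_sum, Finset.mul_sum]
    refine Finset.sum_congr rfl fun β hβ => ?_
    rw [Finset.Nat.mem_antidiagonalTuple] at hβ
    rw [multinomial_univ_cons, hβ, mem_antidiagonal.mp hij]
    simp only [List.ofFn_succ, Fin.cons_zero, Fin.cons_succ, List.prod_cons]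
    push_cast
    rw [mul_assoc, (Nat.cast_commute (Nat.multinomial univ β)
      ((ascPochhammer ℕ ij.1).smeval (y 0))).left_comm]

end Pochhammer

section WeylRelations

variable {E : Type*} [Ring E]

theorem mul_pow_eq_of_weyl {d x : E} (h : d * x = x * d + 1) (a : ℕ) :
    d * x ^ a = x ^ a * d + a * x ^ (a - 1) := by
  induction a with
  | zero => simp
  | succ a ih =>
    rw [pow_succ, ← mul_assoc, ih, add_mul, mul_assoc, h, mul_assoc (a : E)]
    cases a with
    | zero => simp
    | succ a =>
      simp only [Nat.add_sub_cancel, ← pow_succ]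
      push_cast
      noncomm_ring

theorem pow_mul_pow_of_weyl {d x : E} (h : d * x = x * d + 1) (a : ℕ) :
    d ^ a * x ^ a = (ascPochhammer ℕ a).smeval (d * x) := by
  induction a with
  | zero => simp [Polynomial.smeval_one]
  | succ a ih =>
    have : d * x ^ (a + 1) = x ^ a * (d * x + a) := by
      rw [pow_succ, ← mul_assoc, mul_pow_eq_of_weyl h, add_mul, mul_add, mul_assoc, mul_assoc,
        (Nat.cast_commute a _).symm.eq]
      cases a with
      | zero => simp
      | succ a => simp [pow_succ]
    rw [ascPochhammer_smeval_succ, ← ih, pow_succ, mul_assoc, this, mul_assoc]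

theorem prod_ofFn_pow_mul_prod_ofFn_pow {n : ℕ} (d x : Fin n → E)
    (h : ∀ i j, i ≠ j → Commute (d i) (x j)) (α : Fin n → ℕ) :
    (List.ofFn fun i => d i ^ α i).prod * (List.ofFn fun i => x i ^ α i).prod =
      (List.ofFn fun i => d i ^ α i * x i ^ α i).prod := by
  induction n with
  | zero => simp
  | succ n ih =>
    simp only [List.ofFn_succ, List.prod_cons]
    rw [← ih (fun i => d i.succ) (fun i => x i.succ)
      (fun i j hij => h _ _ (by simpa using hij)) fun i => α i.succ]
    have : Commute (List.ofFn fun i : Fin n => d i.succ ^ α i.succ).prod (x 0 ^ α 0) := by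
      refine Commute.list_prod_left _ _ fun z hz => ?_
      obtain ⟨i, rfl⟩ := (List.mem_ofFn' _ _).mp hz
      exact (h _ _ (Fin.succ_ne_zero i)).pow_pow _ _
    simp only [mul_assoc]
    rw [← mul_assoc _ (x 0 ^ α 0), this.eq, mul_assoc]

end WeylRelations

theorem Dpow_eq_prod_ofFn {n : ℕ} {M : Type*} [AddCommGroup M] [Module ℂ M]
    (D : Fin n → Module.End ℂ M) (α : Fin n → ℕ) :
    Dpow D α = (List.ofFn fun i => D i ^ α i).prod := by
  rw [List.ofFn_eq_map, List.prod, List.foldr_map]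
  rfl

section LinearForms

variable {n : ℕ}

theorem eq_sum_coeff_of_isHomogeneous_one {f : MvPolynomial (Fin n) ℂ}
    (hf : f.IsHomogeneous 1) : f = ∑ i, f.coeff (Finsupp.single i 1) • X i := by
  ext m
  simp only [coeff_sum, coeff_smul, coeff_X, smul_eq_mul, mul_ite, mul_one, mul_zero]
  by_cases hm : m.degree = 1
  · obtain ⟨a, rfl⟩ : ∃ a, m = Finsupp.single a 1 := (Finsupp.sum_eq_one_iff m).mp hm
    rw [Finset.sum_eq_single a] <;> simp +contextual [Finsupp.single_left_inj]
  · rw [hf.coeff_eq_zero hm, Finset.sum_eq_zero]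
    intro i _
    rw [if_neg]
    rintro rfl
    simp at hm

theorem X_mem_span_of_iInf_hyp_eq_bot {ι : Type} [Fintype ι] {l : ι → MvPolynomial (Fin n) ℂ}
    (hlh : ∀ i, (l i).IsHomogeneous 1) (hess : (⨅ i, hyp l i) = ⊥) (i : Fin n) :
    (X i : MvPolynomial (Fin n) ℂ) ∈ Submodule.span ℂ (Set.range l) := by
  have hmem : (LinearMap.proj i : (Fin n → ℂ) →ₗ[ℂ] ℂ) ∈
      Submodule.span ℂ (Set.range fun j => toLin (l j)) :=
    mem_span_of_iInf_ker_le_ker (by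
      change (⨅ i, hyp l i) ≤ _
      rw [hess]
      exact bot_le)
  let φ : ((Fin n → ℂ) →ₗ[ℂ] ℂ) →ₗ[ℂ] MvPolynomial (Fin n) ℂ :=
    { toFun := fun f => ∑ a, f (Pi.single a 1) • X a
      map_add' := fun f g => by simp [add_smul, Finset.sum_add_distrib]
      map_smul' := fun c f => by simp [mul_smul, Finset.smul_sum] }
  have hl : ∀ j, φ (toLin (l j)) = l j := fun j => by
    conv_rhs => rw [eq_sum_coeff_of_isHomogeneous_one (hlh j)]
    simp [φ, toLin, Pi.single_apply]
  have hX : φ (LinearMap.proj i) = X i := by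
    simp [φ, Pi.single_apply]
  have := Submodule.mem_map_of_mem (f := φ) hmem
  rw [Submodule.map_span, ← Set.range_comp, hX] at this
  convert this using 3
  exact funext fun j => (hl j).symm

theorem pderiv_pderiv_eq_zero_of_isHomogeneous_one {f : MvPolynomial (Fin n) ℂ}
    (hf : f.IsHomogeneous 1) (i j : Fin n) : pderiv i (pderiv j f) = 0 := by
  rw [eq_sum_coeff_of_isHomogeneous_one hf]
  simp only [map_sum, Derivation.map_smul, pderiv_X, Pi.single_apply]
  refine Finset.sum_eq_zero fun a _ => ?_
  split_ifs <;> simp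

theorem pderiv_comm {σ : Type*} (i j : σ) (f : MvPolynomial σ ℂ) :
    pderiv i (pderiv j f) = pderiv j (pderiv i f) := by
  classical
  induction f using MvPolynomial.induction_on with
  | C a => simp
  | add p q hp hq => simp [hp, hq]
  | mul_X p a hp =>
    simp only [pderiv_mul, map_add, hp, pderiv_X, Pi.single_apply]
    split_ifs <;> simp <;> ring

theorem pderiv_inl_rename_inl {κ : Type*} (i : Fin n) (f : MvPolynomial (Fin n) ℂ) :
    pderiv (Sum.inl i) (rename Sum.inl f : MvPolynomial (Fin n ⊕ κ) ℂ) =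
      rename Sum.inl (pderiv i f) :=
  pderiv_rename Sum.inl_injective i f

theorem pderiv_inl_rename_inr {κ : Type*} (i : Fin n) (f : MvPolynomial κ ℂ) :
    pderiv (Sum.inl i) (rename Sum.inr f : MvPolynomial (Fin n ⊕ κ) ℂ) = 0 := by
  classical
  induction f using MvPolynomial.induction_on with
  | C a => simp
  | add p q hp hq => simp [hp, hq]
  | mul_X p j hp => simp [Derivation.leibniz, hp, pderiv_X]

end LinearForms

section Twisted

variable {n : ℕ} {ι : Type} [Fintype ι] {l : ι → MvPolynomial (Fin n) ℂ}
  {D : Fin n → Module.End ℂ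
    (Localization.Away (rename Sum.inl (∏ i, l i) : MvPolynomial (Fin n ⊕ ι) ℂ))}

/-- The structure map of the localization. -/
noncomputable abbrev toLoc (l : ι → MvPolynomial (Fin n) ℂ) :
    MvPolynomial (Fin n ⊕ ι) ℂ →+*
      Localization.Away (rename Sum.inl (∏ i, l i) : MvPolynomial (Fin n ⊕ ι) ℂ) :=
  algebraMap _ _

/-- Multiplication by a polynomial, as an operator on the localization. -/
noncomputable def mulOp (l : ι → MvPolynomial (Fin n) ℂ) (r : MvPolynomial (Fin n ⊕ ι) ℂ) :
    Module.End ℂ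
      (Localization.Away (rename Sum.inl (∏ i, l i) : MvPolynomial (Fin n ⊕ ι) ℂ)) :=
  LinearMap.mulLeft ℂ (toLoc l r)

theorem mulOp_apply (r : MvPolynomial (Fin n ⊕ ι) ℂ)
    (m : Localization.Away (rename Sum.inl (∏ i, l i) : MvPolynomial (Fin n ⊕ ι) ℂ)) :
    mulOp l r m = toLoc l r * m := rfl

theorem IsTwisted.mul_mulOp (hD : IsTwisted l D) (i : Fin n) (r : MvPolynomial (Fin n ⊕ ι) ℂ) :
    D i * mulOp l r = mulOp l r * D i + mulOp l (pderiv (Sum.inl i) r) := by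
  ext m
  simp only [Module.End.mul_apply, LinearMap.add_apply, mulOp_apply, hD.1]
  rw [add_comm]

theorem IsTwisted.commute_mulOp (hD : IsTwisted l D) (i : Fin n)
    {r : MvPolynomial (Fin n ⊕ ι) ℂ} (hr : pderiv (Sum.inl i) r = 0) :
    Commute (D i) (mulOp l r) := by
  rw [Commute, SemiconjBy, hD.mul_mulOp, hr]
  ext m
  simp [mulOp_apply]

theorem isUnit_algebraMap_form (l : ι → MvPolynomial (Fin n) ℂ) (j : ι) :
    IsUnit (toLoc l
      (rename Sum.inl (l j))) := by
  refine isUnit_of_dvd_unit (map_dvd _ (map_dvd _ (Finset.dvd_prod_of_mem l (Finset.mem_univ j))))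
    (IsLocalization.Away.algebraMap_isUnit
      (rename Sum.inl (∏ i, l i) : MvPolynomial (Fin n ⊕ ι) ℂ))

/-- The twisted derivatives commute as soon as they commute on `1`. -/
theorem IsTwisted.commute_of_apply_one (hD : IsTwisted l D) {i k : Fin n}
    (h : D i (D k 1) = D k (D i 1)) : Commute (D i) (D k) := by
  have hcomm : ∀ r : MvPolynomial (Fin n ⊕ ι) ℂ, ∀ m,
      D i (D k (toLoc l r * m)) - D k (D i (toLoc l r * m)) =
        toLoc l r * (D i (D k m) - D k (D i m)) := fun r m => by
    have hp : pderiv (Sum.inl i) (pderiv (Sum.inl k) r) =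
        pderiv (Sum.inl k) (pderiv (Sum.inl i) r) := pderiv_comm ..
    simp only [hD.1, map_add, hp]
    ring
  ext m
  obtain ⟨⟨r, t⟩, hr⟩ := IsLocalization.surj
    (Submonoid.powers (rename Sum.inl (∏ i, l i) : MvPolynomial (Fin n ⊕ ι) ℂ)) m
  have ht := IsLocalization.map_units
    (Localization.Away (rename Sum.inl (∏ i, l i) : MvPolynomial (Fin n ⊕ ι) ℂ)) t
  rw [Module.End.mul_apply, Module.End.mul_apply, ← sub_eq_zero, ← ht.mul_right_eq_zero, ← hcomm,
    mul_comm, hr]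
  have := hcomm r 1
  rwa [mul_one, h, sub_self, mul_zero] at this

/-- The twisted derivative of `1` is the sum of `sⱼ (∂lⱼ/∂xᵢ)/lⱼ`. -/
theorem IsTwisted.apply_one (hD : IsTwisted l D)
    {v : ι → Localization.Away (rename Sum.inl (∏ i, l i) : MvPolynomial (Fin n ⊕ ι) ℂ)}
    (hv : ∀ j, toLoc l (rename Sum.inl (l j)) * v j = 1) (i : Fin n) :
    D i 1 = ∑ j, toLoc l (X (Sum.inr j) * rename Sum.inl (pderiv i (l j))) * v j := by
  classical
  have hF := IsLocalization.Away.algebraMap_isUnit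
    (S := Localization.Away (rename Sum.inl (∏ i, l i) : MvPolynomial (Fin n ⊕ ι) ℂ))
    (rename Sum.inl (∏ i, l i) : MvPolynomial (Fin n ⊕ ι) ℂ)
  refine hF.mul_left_cancel ?_
  rw [hD.2 i, map_sum, Finset.mul_sum]
  refine Finset.sum_congr rfl fun j _ => ?_
  have : toLoc l (rename Sum.inl (∏ i, l i)) = toLoc l (rename Sum.inl (l j)) *
      toLoc l (rename Sum.inl (∏ k ∈ Finset.univ.erase j, l k)) := by
    rw [← map_mul, ← map_mul, Finset.mul_prod_erase _ _ (Finset.mem_univ j)]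
  rw [this]
  simp only [map_mul]
  linear_combination (-(toLoc l (X (Sum.inr j)) *
    (toLoc l (rename Sum.inl (pderiv i (l j))) *
      toLoc l (rename Sum.inl (∏ k ∈ Finset.univ.erase j, l k))))) * hv j

theorem IsTwisted.apply_inverse (hD : IsTwisted l D) {j : ι}
    {w : Localization.Away (rename Sum.inl (∏ i, l i) : MvPolynomial (Fin n ⊕ ι) ℂ)}
    (hw : toLoc l (rename Sum.inl (l j)) * w = 1) (i : Fin n) :
    D i w = w * D i 1 - toLoc l (rename Sum.inl (pderiv i (l j))) * w ^ 2 := by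
  have h := hD.1 i (rename Sum.inl (l j)) w
  rw [hw, pderiv_inl_rename_inl] at h
  rw [h]
  linear_combination (-(D i w)) * hw

theorem IsTwisted.apply_apply_one (hD : IsTwisted l D) (hlh : ∀ j, (l j).IsHomogeneous 1)
    {v : ι → Localization.Away (rename Sum.inl (∏ i, l i) : MvPolynomial (Fin n ⊕ ι) ℂ)}
    (hv : ∀ j, toLoc l (rename Sum.inl (l j)) * v j = 1) (i k : Fin n) :
    D i (D k 1) = D k 1 * D i 1 -
      ∑ j, toLoc l (X (Sum.inr j)) * toLoc l (rename Sum.inl (pderiv k (l j))) *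
        toLoc l (rename Sum.inl (pderiv i (l j))) * v j ^ 2 := by
  rw [hD.apply_one hv k, map_sum, Finset.sum_mul, ← Finset.sum_sub_distrib]
  refine Finset.sum_congr rfl fun j _ => ?_
  have h0 : pderiv (Sum.inl i) (X (Sum.inr j) * rename Sum.inl (pderiv k (l j)) :
      MvPolynomial (Fin n ⊕ ι) ℂ) = 0 := by
    classical
    simp [Derivation.leibniz, pderiv_inl_rename_inl, pderiv_X,
      pderiv_pderiv_eq_zero_of_isHomogeneous_one (hlh j)]
  rw [hD.1, h0, hD.apply_inverse (hv j), map_zero, map_mul]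
  ring

theorem IsTwisted.commute (hD : IsTwisted l D) (hlh : ∀ j, (l j).IsHomogeneous 1)
    (i k : Fin n) : Commute (D i) (D k) := by
  choose v hv using fun j => (isUnit_algebraMap_form l j).exists_right_inv
  have hsum : ∑ j, toLoc l (X (Sum.inr j)) * toLoc l (rename Sum.inl (pderiv k (l j))) *
        toLoc l (rename Sum.inl (pderiv i (l j))) * v j ^ 2 =
      ∑ j, toLoc l (X (Sum.inr j)) * toLoc l (rename Sum.inl (pderiv i (l j))) *
        toLoc l (rename Sum.inl (pderiv k (l j))) * v j ^ 2 :=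
    Finset.sum_congr rfl fun j _ => by rw [mul_right_comm (toLoc l (X (Sum.inr j)))]
  apply hD.commute_of_apply_one
  rw [hD.apply_apply_one hlh hv i k, hD.apply_apply_one hlh hv k i, hsum, mul_comm (D k 1)]

/-- The twisted Euler operator acts on functions of the parameters by multiplication by
`s₁ + ⋯ + s_p + n`. -/
theorem IsTwisted.euler_apply (hD : IsTwisted l D) (hlh : ∀ j, (l j).IsHomogeneous 1)
    (q : MvPolynomial ι ℂ) :
    (∑ i, D i * mulOp l (X (Sum.inl i))) (toLoc l (rename Sum.inr q)) =
      toLoc l (rename Sum.inr (q * (∑ j, X j + C (n : ℂ)))) := by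
  choose v hv using fun j => (isUnit_algebraMap_form l j).exists_right_inv
  have hone : ∑ i, toLoc l (X (Sum.inl i)) * D i 1 =
      toLoc l
        (∑ j, X (Sum.inr j)) := by
    simp only [hD.apply_one hv, Finset.mul_sum, map_sum]
    rw [Finset.sum_comm]
    refine Finset.sum_congr rfl fun j _ => ?_
    have he := congrArg (fun f => toLoc l (rename Sum.inl f))
      (hlh j).sum_X_mul_pderiv
    simp only [map_sum, map_mul, rename_X, one_smul] at he
    rw [← mul_one (toLoc l (X (Sum.inr j))), ← hv j, ← he, Finset.sum_mul,
      Finset.mul_sum]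
    refine Finset.sum_congr rfl fun i _ => ?_
    rw [map_mul]
    ring
  have hterm : ∀ i, (D i * mulOp l (X (Sum.inl i))) (toLoc l (rename Sum.inr q)) =
      toLoc l (rename Sum.inr q) * (1 + toLoc l (X (Sum.inl i)) * D i 1) :=
    fun i => by
      have h := hD.1 i (rename Sum.inr q) 1
      rw [pderiv_inl_rename_inr, map_zero, zero_mul, zero_add, mul_one] at h
      rw [Module.End.mul_apply, mulOp_apply, hD.1, h, pderiv_X_self, map_one]
      ring
  rw [LinearMap.sum_apply, Finset.sum_congr rfl fun i _ => hterm i, ← Finset.mul_sum,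
    Finset.sum_add_distrib, hone,
    map_natCast C]
  simp only [map_mul, map_add, map_sum, map_natCast, rename_X, Finset.sum_const,
    Finset.card_univ, Fintype.card_fin, nsmul_eq_mul, mul_one]
  ring

theorem IsTwisted.ascPochhammer_euler_apply (hD : IsTwisted l D)
    (hlh : ∀ j, (l j).IsHomogeneous 1) (k : ℕ) (q : MvPolynomial ι ℂ) :
    (ascPochhammer ℕ k).smeval (∑ i, D i * mulOp l (X (Sum.inl i)))
        (toLoc l (rename Sum.inr q)) =
      toLoc l (rename Sum.inr
        (q * ∏ j ∈ Finset.range k, (∑ a, X a + C ((n : ℂ) + (j : ℂ))))) := by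
  induction k generalizing q with
  | zero => simp [Polynomial.smeval_one]
  | succ k ih =>
    rw [ascPochhammer_smeval_succ, Module.End.mul_apply, LinearMap.add_apply,
      hD.euler_apply hlh, Module.End.natCast_apply, nsmul_eq_mul, Finset.prod_range_succ]
    have : (k : Localization.Away
        (rename Sum.inl (∏ i, l i) : MvPolynomial (Fin n ⊕ ι) ℂ)) *
        toLoc l (rename Sum.inr q) = toLoc l (rename Sum.inr (q * C (k : ℂ))) := by
      simp [mul_comm]
    rw [this, ← map_add, ← map_add, ih]
    congr 2
    rw [C_add]
    ring

theorem IsTwisted.commute_mul_mulOp_X (hD : IsTwisted l D) (hlh : ∀ j, (l j).IsHomogeneous 1)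
    (i k : Fin n) :
    Commute (D i * mulOp l (X (Sum.inl i))) (D k * mulOp l (X (Sum.inl k))) := by
  classical
  rcases eq_or_ne i k with rfl | hik
  · exact Commute.refl _
  have hDX : ∀ {a b : Fin n}, a ≠ b → Commute (D a) (mulOp l (X (Sum.inl b))) := fun hab =>
    hD.commute_mulOp _ (pderiv_X_of_ne (by simpa using hab.symm))
  have hXX : Commute (mulOp l (X (Sum.inl i))) (mulOp l (X (Sum.inl k))) := by
    ext m
    simp only [Module.End.mul_apply, mulOp_apply]
    ring
  exact ((hD.commute hlh i k).mul_right (hDX hik)).mul_left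
    ((hDX hik.symm).symm.mul_right hXX)

theorem IsTwisted.Dpow_apply (hD : IsTwisted l D) (α : Fin n → ℕ) :
    Dpow D α (toLoc l (∏ i, X (Sum.inl i) ^ α i)) =
      (List.ofFn fun i =>
        (ascPochhammer ℕ (α i)).smeval (D i * mulOp l (X (Sum.inl i)))).prod 1 := by
  have hweyl : ∀ i, D i * mulOp l (X (Sum.inl i)) = mulOp l (X (Sum.inl i)) * D i + 1 :=
    fun i => by
      rw [hD.mul_mulOp, pderiv_X_self]
      congr 1
      ext m
      simp [mulOp_apply]
  have hDX : ∀ a b : Fin n, a ≠ b → Commute (D a) (mulOp l (X (Sum.inl b))) := fun a b hab =>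
    hD.commute_mulOp _ (pderiv_X_of_ne (by simpa using hab.symm))
  have hmon : ((List.ofFn fun i => mulOp l (X (Sum.inl i)) ^ α i).prod) 1 =
      toLoc l
        (∏ i, X (Sum.inl i) ^ α i) := by
    let φ : MvPolynomial (Fin n ⊕ ι) ℂ →+* Module.End ℂ (Localization.Away
        (rename Sum.inl (∏ i, l i) : MvPolynomial (Fin n ⊕ ι) ℂ)) :=
      (Algebra.lmul ℂ _).toRingHom.comp (toLoc l)
    have hφ : ∀ r, φ r = mulOp l r := fun r => rfl
    have := map_list_prod φ (List.ofFn fun i => (X (Sum.inl i) : MvPolynomial (Fin n ⊕ ι) ℂ) ^ α i)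
    rw [List.map_ofFn, List.prod_ofFn] at this
    simp only [Function.comp_def, map_pow] at this
    simp only [hφ] at this
    rw [← this, mulOp_apply, mul_one]
  rw [← hmon, Dpow_eq_prod_ofFn, ← Module.End.mul_apply, prod_ofFn_pow_mul_prod_ofFn_pow _ _ hDX]
  simp only [pow_mul_pow_of_weyl (hweyl _)]

end Twisted

end Arrangement

open Arrangement in
/-- If the linear forms `l₁,…,l_p` span the linear forms on `ℂⁿ`
(equivalently `⋂ ker lᵢ = 0`), then for every `k ≥ 1` there are elements `g_α` of
`(l₁,…,l_p)^k` with
`∏_{j=0}^{k−1} (s₁+⋯+s_p+n+j) · 1 = ∑_{|α|=k} (k!/(α₁!⋯αₙ!)) · D^α(g_α)` in `M`. -/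
theorem prod_linear_mem_image_of_essential
    (n p : ℕ) (hp : 1 ≤ p) (l : Fin p → MvPolynomial (Fin n) ℂ)
    (hl0 : ∀ i, l i ≠ 0) (hlh : ∀ i, (l i).IsHomogeneous 1)
    (hprop : ∀ i j, i ≠ j → ∀ c : ℂ, l i ≠ c • l j)
    (hess : (⨅ i, hyp l i) = ⊥)
    (D : Fin n → Module.End ℂ
      (Localization.Away (rename Sum.inl (∏ i, l i) : MvPolynomial (Fin n ⊕ Fin p) ℂ)))
    (hD : IsTwisted l D) (k : ℕ) (hk : 1 ≤ k) :
    ∃ g : (Fin n → ℕ) → MvPolynomial (Fin n ⊕ Fin p) ℂ,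
      (∀ α ∈ Finset.Nat.antidiagonalTuple n k,
        g α ∈ (Ideal.span (Set.range fun i =>
          (rename Sum.inl (l i) : MvPolynomial (Fin n ⊕ Fin p) ℂ))) ^ k) ∧
      algebraMap (MvPolynomial (Fin n ⊕ Fin p) ℂ) _
          (∏ j ∈ Finset.range k, ((∑ jj : Fin p, X (Sum.inr jj)) + C ((n : ℂ) + (j : ℂ))))
        = ∑ α ∈ Finset.Nat.antidiagonalTuple n k,
            (Nat.multinomial Finset.univ α :
              Localization.Away (rename Sum.inl (∏ i, l i) : MvPolynomial (Fin n ⊕ Fin p) ℂ)) *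
              (Dpow D α) (algebraMap _ _ (g α)) := by
  classical
  refine ⟨fun α => ∏ i, X (Sum.inl i) ^ α i, fun α hα => ?_, ?_⟩
  · have hX : ∀ i : Fin n, (X (Sum.inl i) : MvPolynomial (Fin n ⊕ Fin p) ℂ) ∈
        Ideal.span (Set.range fun i =>
          (rename Sum.inl (l i) : MvPolynomial (Fin n ⊕ Fin p) ℂ)) := fun i => by
      have h := Submodule.mem_map_of_mem
        (f := (rename Sum.inl : MvPolynomial (Fin n) ℂ →ₐ[ℂ]
          MvPolynomial (Fin n ⊕ Fin p) ℂ).toLinearMap)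
        (X_mem_span_of_iInf_hyp_eq_bot hlh hess i)
      rw [Submodule.map_span, ← Set.range_comp, AlgHom.toLinearMap_apply, rename_X] at h
      exact Submodule.span_le_restrictScalars ℂ (MvPolynomial (Fin n ⊕ Fin p) ℂ) _ h
    rw [← Finset.Nat.mem_antidiagonalTuple.mp hα, ← Finset.prod_pow_eq_pow_sum]
    exact Ideal.prod_mem_prod fun i _ => Ideal.pow_mem_pow (hX i) _
  · have hsum := congrArg (fun T => T 1) (sum_multinomial_mul_prod_ascPochhammer _
      (hD.commute_mul_mulOp_X hlh) k)
    have heuler := hD.ascPochhammer_euler_apply hlh k 1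
    simp only [map_one] at heuler
    simp only [heuler, LinearMap.sum_apply, Module.End.mul_apply, Module.End.natCast_apply,
      nsmul_eq_mul, ← hD.Dpow_apply] at hsum
    rw [hsum]
    simp
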